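/- arXiv:0812.1616 — 2 statements merged into one kernel-verified Lean document; each statement's English description precedes it below -/
import Mathlib

section
/- Let G be a connected simple graph on n ≥ 2 vertices. Then mr(G) = n − 1 if and only if G is isomorphic to the path P_n. Consequently, if a connected graph G on n vertices is not a path, then mr(G) ≤ n − 2. -/
open Matrix

/-- `A` is a real symmetric matrix whose off-diagonal zero–nonzero pattern is described by the
simple graph `G`: for `i ≠ j`, `A i j ≠ 0` iff `{i,j}` is an edge of `G`. Diagonal entries are
unconstrained. -/
def DescribesGraph {V : Type*} [Fintype V] (G : SimpleGraph V) (A : Matrix V V ℝ) : Prop :=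
  A.IsSymm ∧ ∀ i j : V, i ≠ j → (A i j ≠ 0 ↔ G.Adj i j)

/-- The minimum rank `mr(G)` of a simple graph `G`: the smallest rank of a real symmetric matrix
described by `G`. -/
noncomputable def minrank {V : Type*} [Fintype V] (G : SimpleGraph V) : ℕ :=
  sInf {r : ℕ | ∃ A : Matrix V V ℝ, DescribesGraph G A ∧ A.rank = r}

open Module in
theorem Matrix.rank_add_two_le_card {V : Type*} [Fintype V] {A : Matrix V V ℝ} {x y : V → ℝ}
    (hx : A *ᵥ x = 0) (hy : A *ᵥ y = 0) (hxy : LinearIndependent ℝ ![x, y]) :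
    A.rank + 2 ≤ Fintype.card V := by
  have h1 := LinearMap.finrank_range_add_finrank_ker A.mulVecLin
  have h2 : 2 ≤ finrank ℝ (LinearMap.ker A.mulVecLin) := by
    have h3 : LinearIndependent ℝ
        (![⟨x, by simpa using hx⟩, ⟨y, by simpa using hy⟩] : Fin 2 → LinearMap.ker A.mulVecLin) := by
      refine LinearIndependent.of_comp (LinearMap.ker A.mulVecLin).subtype ?_
      convert hxy using 1
      ext i j
      fin_cases i <;> rfl
    simpa using h3.fintype_card_le_finrank
  rw [finrank_fintype_fun_eq_card] at h1
  unfold Matrix.rank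
  omega

theorem minrank_le_of_describesGraph {V : Type*} [Fintype V] {G : SimpleGraph V}
    {A : Matrix V V ℝ} (hA : DescribesGraph G A) : minrank G ≤ A.rank :=
  Nat.sInf_le ⟨A, hA, rfl⟩

open scoped Classical in
theorem describesGraph_lapMatrix {V : Type*} [Fintype V] (G : SimpleGraph V) :
    DescribesGraph G (G.lapMatrix ℝ) := by
  refine ⟨G.isSymm_lapMatrix (R := ℝ), fun i j hij => ?_⟩
  simp [SimpleGraph.lapMatrix, SimpleGraph.degMatrix, hij]

theorem exists_describesGraph_rank_eq_minrank {V : Type*} [Fintype V] (G : SimpleGraph V) :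
    ∃ A : Matrix V V ℝ, DescribesGraph G A ∧ A.rank = minrank G := by
  classical
  exact Nat.sInf_mem (s := {r : ℕ | ∃ A : Matrix V V ℝ, DescribesGraph G A ∧ A.rank = r})
    ⟨_, _, describesGraph_lapMatrix G, rfl⟩

open Module in
theorem minrank_add_one_le_card {V : Type*} [Fintype V] [Nonempty V] (G : SimpleGraph V) :
    minrank G + 1 ≤ Fintype.card V := by
  classical
  refine (Nat.add_le_add_right (minrank_le_of_describesGraph (describesGraph_lapMatrix G)) 1).trans ?_
  have h1 := LinearMap.finrank_range_add_finrank_ker (G.lapMatrix ℝ).mulVecLin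
  have h2 : 0 < finrank ℝ (LinearMap.ker (G.lapMatrix ℝ).mulVecLin) := by
    refine Module.finrank_pos_iff_exists_ne_zero.mpr
      ⟨⟨fun _ => 1, by simpa using G.lapMatrix_mulVec_const_eq_zero⟩, fun h => ?_⟩
    obtain ⟨v⟩ := ‹Nonempty V›
    simpa using congrFun (congrArg Subtype.val h) v
  rw [finrank_fintype_fun_eq_card] at h1
  unfold Matrix.rank
  omega

open Module in
/-- The minimum rank of a path is at least its order minus one: a kernel vector of a matrix
described by a path is determined by its first coordinate. -/
theorem card_le_minrank_add_one_of_iso_pathGraph {n : ℕ} (hn : 0 < n) {V : Type*} [Fintype V]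
    {G : SimpleGraph V} (e : G ≃g SimpleGraph.pathGraph n) : Fintype.card V ≤ minrank G + 1 := by
  obtain ⟨A, ⟨-, hA⟩, hr⟩ := exists_describesGraph_rank_eq_minrank G
  rw [← hr]
  have h1 := LinearMap.finrank_range_add_finrank_ker A.mulVecLin
  have hadj (i j : Fin n) (hij : i ≠ j) :
      A (e.symm i) (e.symm j) ≠ 0 ↔ (i : ℕ) + 1 = j ∨ (j : ℕ) + 1 = i := by
    rw [hA _ _ (by simpa using hij), e.symm.map_adj_iff, SimpleGraph.pathGraph_adj]
  have key (x : V → ℝ) (hx : A *ᵥ x = 0) (h0 : x (e.symm ⟨0, hn⟩) = 0) : x = 0 := by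
    have h (k : ℕ) : ∀ hk : k < n, x (e.symm ⟨k, hk⟩) = 0 := by
      induction k using Nat.strong_induction_on with
      | _ k ih =>
        intro hk
        rcases k with _ | k
        · exact h0
        have hrow := congrFun hx (e.symm ⟨k, by omega⟩)
        simp only [mulVec, dotProduct, Pi.zero_apply] at hrow
        rw [← e.symm.toEquiv.sum_comp, Finset.sum_eq_single ⟨k + 1, hk⟩] at hrow
        · refine (mul_eq_zero.mp hrow).resolve_left ?_
          exact (hadj ⟨k, by omega⟩ ⟨k + 1, hk⟩ (by simp)).mpr (Or.inl rfl)
        · rintro ⟨j, hj⟩ - hjk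
          by_cases hlt : j < k + 1
          · exact mul_eq_zero_of_right _ (ih j hlt hj)
          · refine mul_eq_zero_of_left ?_ _
            by_contra hne
            have := (hadj ⟨k, by omega⟩ ⟨j, hj⟩ (by simp; omega)).mp hne
            simp at this hjk
            omega
        · simp
    ext v
    simpa using h (e v) (e v).isLt
  let φ : LinearMap.ker A.mulVecLin →ₗ[ℝ] ℝ :=
    (LinearMap.proj (e.symm ⟨0, hn⟩)).comp (LinearMap.ker A.mulVecLin).subtype
  have hφ : Function.Injective φ := by
    rw [← LinearMap.ker_eq_bot, LinearMap.ker_eq_bot']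
    rintro ⟨x, hx⟩ h
    exact Subtype.ext (key x (by simpa using hx) h)
  have h2 := LinearMap.finrank_le_finrank_of_injective hφ
  rw [finrank_self] at h2
  rw [finrank_fintype_fun_eq_card] at h1
  unfold Matrix.rank
  omega

namespace SimpleGraph

variable {V : Type*} [Fintype V]

/-- The real circulations of a graph: antisymmetric functions on pairs of vertices supported on
edges and conserved at every vertex. -/
def circulations (G : SimpleGraph V) : Submodule ℝ (V → V → ℝ) where
  carrier := {f | (∀ i j, f j i = -f i j) ∧ (∀ i j, ¬ G.Adj i j → f i j = 0) ∧ ∀ i, ∑ j, f i j = 0}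
  zero_mem' := by simp
  add_mem' := by
    rintro f g ⟨hf₁, hf₂, hf₃⟩ ⟨hg₁, hg₂, hg₃⟩
    refine ⟨fun i j => ?_, fun i j h => ?_, fun i => ?_⟩
    · simp only [Pi.add_apply, hf₁ i j, hg₁ i j]; ring
    · simp [hf₂ i j h, hg₂ i j h]
    · simp [Finset.sum_add_distrib, hf₃, hg₃]
  smul_mem' := by
    rintro c f ⟨hf₁, hf₂, hf₃⟩
    refine ⟨fun i j => ?_, fun i j h => ?_, fun i => ?_⟩
    · simp [hf₁ i j]
    · simp [hf₂ i j h]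
    · simp [← Finset.mul_sum, hf₃]

theorem Reachable.exists_unit_flow [DecidableEq V] {H : SimpleGraph V} {a b : V}
    (h : H.Reachable a b) :
    ∃ g : V → V → ℝ, (∀ i j, g j i = -g i j) ∧ (∀ i j, ¬ H.Adj i j → g i j = 0) ∧
      ∀ i, ∑ j, g i j = (if i = a then 1 else 0) - (if i = b then 1 else 0) := by
  obtain ⟨p⟩ := h
  induction p with
  | nil => exact ⟨0, by simp, by simp, by simp⟩
  | @cons u v w huv p ih =>
    obtain ⟨g, hg₁, hg₂, hg₃⟩ := ih
    refine ⟨fun i j => g i j + ((if i = u ∧ j = v then 1 else 0) -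
      (if i = v ∧ j = u then 1 else 0)), fun i j => ?_, fun i j hij => ?_, fun i => ?_⟩
    · simp only [hg₁ i j, and_comm]; ring
    · have h₁ : ¬ (i = u ∧ j = v) := by rintro ⟨rfl, rfl⟩; exact hij huv
      have h₂ : ¬ (i = v ∧ j = u) := by rintro ⟨rfl, rfl⟩; exact hij huv.symm
      simp [hg₂ i j hij, h₁, h₂]
    · simp only [Finset.sum_add_distrib, Finset.sum_sub_distrib, hg₃, ite_and]
      by_cases h₁ : i = u <;> by_cases h₂ : i = v <;> simp [h₁, h₂]

/-- A path in `H` closed up by an edge `ab` of `G` outside `H` carries a circulation. -/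
theorem Reachable.exists_mem_circulations {G H : SimpleGraph V} (hHG : H ≤ G) {a b : V}
    (h : H.Reachable a b) (hG : G.Adj a b) (hH : ¬ H.Adj a b) :
    ∃ f ∈ G.circulations, f a b ≠ 0 ∧ ∃ i j, H.Adj i j ∧ f i j ≠ 0 := by
  classical
  obtain ⟨g, hg₁, hg₂, hg₃⟩ := h.exists_unit_flow
  have hab := hG.ne
  refine ⟨fun i j => g i j - ((if i = a ∧ j = b then 1 else 0) -
      (if i = b ∧ j = a then 1 else 0)), ⟨fun i j => ?_, fun i j hij => ?_, fun i => ?_⟩, ?_, ?_⟩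
  · simp only [hg₁ i j, and_comm]; ring
  · have h₁ : ¬ (i = a ∧ j = b) := by rintro ⟨rfl, rfl⟩; exact hij hG
    have h₂ : ¬ (i = b ∧ j = a) := by rintro ⟨rfl, rfl⟩; exact hij hG.symm
    simp [hg₂ i j (fun h => hij (hHG h)), h₁, h₂]
  · simp only [Finset.sum_sub_distrib, hg₃, ite_and]
    by_cases h₁ : i = a <;> by_cases h₂ : i = b <;> simp [h₁, h₂]
  · simp [hg₂ a b hH, hab]
  · by_contra! hzero
    have hg : g = 0 := by
      ext i j
      by_cases hij : H.Adj i j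
      · have h₁ : ¬ (i = a ∧ j = b) := by rintro ⟨rfl, rfl⟩; exact hH hij
        have h₂ : ¬ (i = b ∧ j = a) := by rintro ⟨rfl, rfl⟩; exact hH hij.symm
        simpa [h₁, h₂] using hzero i j hij
      · exact hg₂ i j hij
    simpa [hg, hab] using hg₃ a

theorem exists_circulation_forall_ne_zero (G : SimpleGraph V) :
    ∃ f ∈ G.circulations, ∀ i j, f i j = 0 → ∀ g ∈ G.circulations, g i j = 0 := by
  obtain ⟨f, hf, h⟩ := Module.Dual.exists_forall_mem_ne_zero_of_forall_exists
    (ι := {e : V × V // ∃ g ∈ G.circulations, g e.1 e.2 ≠ 0}) G.circulations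
    (fun e => (LinearMap.proj (R := ℝ) (φ := fun _ : V => ℝ) e.1.2).comp
      (LinearMap.proj (φ := fun _ : V => V → ℝ) e.1.1)) fun ⟨_, he⟩ => he
  refine ⟨f, hf, fun i j hij => ?_⟩
  by_contra! hne
  exact h ⟨(i, j), hne⟩ hij

/-- Given a circulation `f` and a potential `t` such that `f` vanishes on every edge on which `t`
is constant, the weighted Laplacian with weights `f i j / (t j - t i)` has both the constants and
`t` in its kernel. -/
theorem exists_describesGraph_mulVec_eq_zero {G : SimpleGraph V} {f : V → V → ℝ}
    (hf : f ∈ G.circulations) {t : V → ℝ}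
    (ht : ∀ i j, G.Adj i j → (f i j = 0 ↔ t i = t j)) :
    ∃ A : Matrix V V ℝ, DescribesGraph G A ∧ A *ᵥ 1 = 0 ∧ A *ᵥ t = 0 := by
  classical
  obtain ⟨hf₁, hf₂, hf₃⟩ := hf
  let w (i j : V) : ℝ := if G.Adj i j then (if t i = t j then 1 else f i j / (t j - t i)) else 0
  have hw₁ (i j : V) : w i j = w j i := by
    simp only [w, G.adj_comm j i, eq_comm (a := t j), hf₁ i j]
    rw [← neg_sub (t j) (t i), neg_div_neg_eq]
  have hw₂ (i j : V) : w i j ≠ 0 ↔ G.Adj i j := by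
    by_cases h : G.Adj i j <;> by_cases h' : t i = t j <;> simp [w, h, h']
    exact ⟨fun h0 => h' ((ht i j h).mp h0), fun h0 => h' (sub_eq_zero.mp h0).symm⟩
  have hw₃ (i j : V) : w i j * (t j - t i) = f i j := by
    by_cases h : G.Adj i j
    · by_cases h' : t i = t j
      · simp [h', (ht i j h).mpr h']
      · have : t j - t i ≠ 0 := sub_ne_zero.mpr (Ne.symm h')
        simp [w, h, h', this]
    · simp [w, h, hf₂ i j h]
  have hmul (x : V → ℝ) (i : V) : ((Matrix.of w - Matrix.diagonal fun i => ∑ j, w i j) *ᵥ x) i =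
      ∑ j, w i j * (x j - x i) := by
    rw [sub_mulVec, Pi.sub_apply, mulVec_diagonal]
    simp [mulVec, dotProduct, mul_sub, Finset.sum_sub_distrib, Finset.sum_mul]
  refine ⟨Matrix.of w - Matrix.diagonal fun i => ∑ j, w i j, ⟨?_, fun i j hij => ?_⟩, ?_, ?_⟩
  · refine IsSymm.sub ?_ (isSymm_diagonal _)
    ext i j
    exact hw₁ j i
  · simpa [hij] using hw₂ i j
  · ext i
    simp [hmul]
  · ext i
    simp [hmul, hw₃, hf₃]

theorem minrank_add_two_le_card_of_not_isAcyclic {G : SimpleGraph V} (hG : ¬ G.IsAcyclic) :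
    minrank G + 2 ≤ Fintype.card V := by
  classical
  rw [isAcyclic_iff_forall_adj_isBridge] at hG
  push Not at hG
  obtain ⟨a, b, hab, hbridge⟩ := hG
  rw [isBridge_iff, not_not] at hbridge
  obtain ⟨f₀, hf₀, hf₀ab, -⟩ := hbridge.exists_mem_circulations (deleteEdges_le _) hab (by simp)
  obtain ⟨f, hf, hgen⟩ := G.exists_circulation_forall_ne_zero
  let H : SimpleGraph V :=
    { Adj := fun i j => G.Adj i j ∧ f i j = 0
      symm := ⟨fun i j h => ⟨h.1.symm, by rw [hf.1 i j, h.2, neg_zero]⟩⟩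
      loopless := ⟨fun i h => h.1.ne rfl⟩ }
  have hHG : H ≤ G := fun i j h => h.1
  let t (i : V) : ℝ := (Finite.equivFin H.ConnectedComponent (H.connectedComponentMk i) : ℕ)
  have htr (i j : V) : t i = t j ↔ H.Reachable i j := by
    simp [t, Fin.val_inj]
  have ht (i j : V) (hij : G.Adj i j) : f i j = 0 ↔ t i = t j := by
    rw [htr]
    refine ⟨fun h => Adj.reachable (G := H) ⟨hij, h⟩, fun h => ?_⟩
    by_contra hne
    obtain ⟨g, hg, -, k, l, hkl, hgkl⟩ := h.exists_mem_circulations hHG hij (fun h' => hne h'.2)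
    exact hgkl (hgen k l hkl.2 g hg)
  obtain ⟨A, hA, hA₁, hA₂⟩ := exists_describesGraph_mulVec_eq_zero hf ht
  refine (Nat.add_le_add_right (minrank_le_of_describesGraph hA) 2).trans
    (Matrix.rank_add_two_le_card hA₁ hA₂ ?_)
  rw [LinearIndependent.pair_iff]
  intro c d hcd
  have h₁ := congrFun hcd a
  have h₂ := congrFun hcd b
  have h₃ : t b - t a ≠ 0 := fun h =>
    hf₀ab (hgen a b ((ht a b hab).mpr (sub_eq_zero.mp h).symm) f₀ hf₀)
  simp only [Pi.add_apply, Pi.smul_apply, Pi.one_apply, smul_eq_mul, Pi.zero_apply, mul_one]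
    at h₁ h₂
  have hd : d = 0 := (mul_eq_zero.mp (by linarith : d * (t b - t a) = 0)).resolve_right h₃
  exact ⟨by simpa [hd] using h₁, hd⟩

theorem IsAcyclic.eq_of_reachable_deleteIncidenceSet {W : Type*} {G : SimpleGraph W}
    (hG : G.IsAcyclic) {v a b : W} (ha : G.Adj v a) (hb : G.Adj v b)
    (h : (G.deleteIncidenceSet v).Reachable a b) : a = b := by
  by_contra hab
  refine isBridge_iff.mp (isAcyclic_iff_forall_adj_isBridge.mp hG ha) ?_
  have hvb : (G.deleteEdges {s(v, a)}).Adj v b := by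
    simp [deleteEdges_adj, hb, Ne.symm hab, ha.ne]
  refine hvb.reachable.trans (h.symm.mono fun x y hxy => ?_)
  rw [deleteIncidenceSet_adj] at hxy
  simp [deleteEdges_adj, hxy.1, hxy.2.1, hxy.2.2]

theorem minrank_add_two_le_card_of_isAcyclic {G : SimpleGraph V} (hG : G.IsAcyclic)
    {v a b c : V} (ha : G.Adj v a) (hb : G.Adj v b) (hc : G.Adj v c) (hab : a ≠ b) (hac : a ≠ c)
    (hbc : b ≠ c) : minrank G + 2 ≤ Fintype.card V := by
  classical
  let H := G.deleteIncidenceSet v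
  have hHG {i j : V} : H.Adj i j ↔ G.Adj i j ∧ i ≠ v ∧ j ≠ v := deleteIncidenceSet_adj
  let S : Matrix V V ℝ := Matrix.of fun i j => if G.Adj i j ∧ ¬ H.Adj i j then 1 else 0
  let x (p q i : V) : ℝ := (if H.Reachable p i then 1 else 0) - (if H.Reachable q i then 1 else 0)
  have hreach {p q : V} (hp : G.Adj v p) (hq : G.Adj v q) : H.Reachable p q ↔ p = q :=
    ⟨hG.eq_of_reachable_deleteIncidenceSet hp hq, fun h => h ▸ Reachable.refl _⟩
  have hv {p : V} (hp : G.Adj v p) : ¬ H.Reachable p v := by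
    rintro ⟨q⟩
    have := q.reverse.adj_snd (by simpa using q.reverse.not_nil_of_ne hp.ne)
    exact (hHG.mp this).2.1 rfl
  have hker {p q : V} (hp : G.Adj v p) (hq : G.Adj v q) :
      (H.lapMatrix ℝ - S) *ᵥ x p q = 0 := by
    have hlap : H.lapMatrix ℝ *ᵥ x p q = 0 := by
      rw [lapMatrix_mulVec_eq_zero_iff_forall_reachable]
      intro i j hij
      have hp' : H.Reachable p i ↔ H.Reachable p j :=
        ⟨fun h => h.trans hij, fun h => h.trans hij.symm⟩
      have hq' : H.Reachable q i ↔ H.Reachable q j :=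
        ⟨fun h => h.trans hij, fun h => h.trans hij.symm⟩
      simp only [x, hp', hq']
    rw [sub_mulVec, hlap, zero_sub, neg_eq_zero]
    ext i
    simp only [mulVec, dotProduct, Pi.zero_apply]
    by_cases hi : i = v
    · subst hi
      have (j : V) : S i j * x p q j = (if j = p then 1 else 0) - (if j = q then 1 else 0) := by
        by_cases hj : G.Adj i j
        · simp [S, x, hHG, hj, hreach hp hj, hreach hq hj, eq_comm]
        · have h₁ : j ≠ p := by rintro rfl; exact hj hp
          have h₂ : j ≠ q := by rintro rfl; exact hj hq
          simp [S, hj, h₁, h₂]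
      simp [this]
    · refine Finset.sum_eq_zero fun j _ => ?_
      by_cases hj : j = v
      · subst hj
        simp [x, hv hp, hv hq]
      · simp [S, hHG, hi, hj]
  have hA : DescribesGraph G (H.lapMatrix ℝ - S) := by
    refine ⟨(H.isSymm_lapMatrix (R := ℝ)).sub ?_, fun i j hij => ?_⟩
    · ext i j
      simp [S, G.adj_comm, H.adj_comm]
    · by_cases h : G.Adj i j <;> by_cases h' : H.Adj i j <;>
        simp [lapMatrix, degMatrix, S, hij, h, h']
      exact h (hHG.mp h').1
  refine (Nat.add_le_add_right (minrank_le_of_describesGraph hA) 2).trans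
    (Matrix.rank_add_two_le_card (hker ha hc) (hker hb hc) ?_)
  rw [LinearIndependent.pair_iff]
  intro s t hst
  have h₁ := congrFun hst a
  have h₂ := congrFun hst b
  simp only [Pi.add_apply, Pi.smul_apply, smul_eq_mul, Pi.zero_apply, x, hreach ha ha, hreach ha hb,
    hreach hb ha, hreach hb hb, hreach hc ha, hreach hc hb, hab, hab.symm, hac.symm, hbc.symm,
    if_true, if_false] at h₁ h₂
  exact ⟨by linarith, by linarith⟩

theorem IsAcyclic.eq_add_one_of_adj_getVert {W : Type*} {G : SimpleGraph W} (hG : G.IsAcyclic)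
    {u v : W} {p : G.Walk u v} (hp : p.IsPath) {i j : ℕ} (hij : i < j) (hj : j ≤ p.length)
    (h : G.Adj (p.getVert i) (p.getVert j)) : i + 1 = j := by
  have hend : (p.drop i).getVert (j - i) = p.getVert j := by
    rw [Walk.drop_getVert]; congr 1; omega
  let q : G.Path (p.getVert i) (p.getVert j) :=
    ⟨((p.drop i).take (j - i)).copy rfl hend, by simpa using (hp.drop i).take (j - i)⟩
  have hq := congrArg (fun r => r.1.length)
    ((hG.subsingleton_path _ _).elim q (Path.singleton h))
  simp [q, Path.singleton] at hq
  omega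

/-- A connected acyclic graph without a vertex of degree at least three is a path. -/
theorem IsAcyclic.nonempty_iso_pathGraph {G : SimpleGraph V} (hG : G.IsAcyclic)
    (hconn : G.Connected) (hdeg : ∀ v a b c, G.Adj v a → G.Adj v b → G.Adj v c →
      a ≠ b → a ≠ c → b = c) : Nonempty (G ≃g pathGraph (Fintype.card V)) := by
  classical
  have := hconn.nonempty
  obtain ⟨u, v, p, hp, hmax⟩ := Walk.exists_isPath_forall_isPath_length_le_length G
  have hsupp (w : V) : w ∈ p.support := by
    by_contra hw
    obtain ⟨q⟩ := hconn.preconnected u w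
    obtain ⟨⟨⟨x, y⟩, hxy⟩, -, hx, hy⟩ :=
      q.exists_boundary_dart {z | z ∈ p.support} p.start_mem_support hw
    simp only [Set.mem_ofPred_eq] at hx hy
    change G.Adj x y at hxy
    obtain ⟨k, rfl, hk⟩ := Walk.mem_support_iff_exists_getVert.mp hx
    have hny (i : ℕ) : p.getVert i ≠ y := fun h => hy (h ▸ p.getVert_mem_support i)
    rcases Nat.eq_zero_or_pos k with rfl | hk0
    · rw [Walk.getVert_zero] at hxy
      simpa using hmax _ _ _ (hp.cons hy (h := hxy.symm))
    rcases hk.eq_or_lt with rfl | hkl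
    · rw [Walk.getVert_length] at hxy
      simpa using hmax _ _ _ (hp.concat hy hxy)
    have h₁ := p.adj_getVert_succ hkl
    have h₂ := p.adj_getVert_succ (i := k - 1) (by omega)
    rw [Nat.sub_add_cancel hk0] at h₂
    refine hny (k + 1) (hdeg _ _ _ _ h₂.symm h₁ hxy (fun h => ?_) (hny _))
    have := hp.getVert_injOn (by simp; omega) (by simp; omega) h
    omega
  let φ : Fin (p.length + 1) → V := fun i => p.getVert i
  have hφ : Function.Bijective φ := by
    refine ⟨fun i j h => Fin.ext (hp.getVert_injOn ?_ ?_ h), fun w => ?_⟩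
    · simpa using Nat.le_of_lt_succ i.isLt
    · simpa using Nat.le_of_lt_succ j.isLt
    · obtain ⟨k, rfl, hk⟩ := Walk.mem_support_iff_exists_getVert.mp (hsupp w)
      exact ⟨⟨k, by omega⟩, rfl⟩
  rw [← Fintype.card_congr (Equiv.ofBijective φ hφ), Fintype.card_fin]
  refine ⟨RelIso.symm ⟨Equiv.ofBijective φ hφ, fun {i j} => ?_⟩⟩
  simp only [Equiv.ofBijective_apply, φ, pathGraph_adj]
  refine ⟨fun h => ?_, ?_⟩
  · rcases lt_trichotomy (i : ℕ) j with hij | hij | hij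
    · exact Or.inl (hG.eq_add_one_of_adj_getVert hp hij (by omega) h)
    · exact absurd (congrArg p.getVert hij) h.ne
    · exact Or.inr (hG.eq_add_one_of_adj_getVert hp hij (by omega) h.symm)
  · rintro (h | h)
    · rw [← h]
      exact p.adj_getVert_succ (by omega)
    · rw [← h]
      exact (p.adj_getVert_succ (by omega)).symm

end SimpleGraph

/-- A connected graph `G` on `n ≥ 2` vertices has `mr(G) = n - 1` iff `G` is isomorphic to the
path `P_n`; consequently a connected non-path has `mr(G) ≤ n - 2`. -/
theorem minrank_eq_card_sub_one_iff_path (n : ℕ) (hn : 2 ≤ n) (G : SimpleGraph (Fin n))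
    (hG : G.Connected) :
    (minrank G = n - 1 ↔ Nonempty (G ≃g SimpleGraph.pathGraph n)) ∧
      (¬ Nonempty (G ≃g SimpleGraph.pathGraph n) → minrank G ≤ n - 2) := by
  have : NeZero n := ⟨by omega⟩
  have hnot (h : ¬ Nonempty (G ≃g SimpleGraph.pathGraph n)) : minrank G + 2 ≤ n := by
    by_cases hac : G.IsAcyclic
    · by_contra hlt
      refine h ?_
      have := hac.nonempty_iso_pathGraph hG fun v a b c ha hb hc hab hac' => by
        by_contra hbc
        exact hlt (by simpa using
          SimpleGraph.minrank_add_two_le_card_of_isAcyclic hac ha hb hc hab hac' hbc)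
      rwa [Fintype.card_fin] at this
    · simpa using SimpleGraph.minrank_add_two_le_card_of_not_isAcyclic hac
  refine ⟨⟨fun h => ?_, fun ⟨e⟩ => ?_⟩, fun h => ?_⟩
  · by_contra hne
    have := hnot hne
    omega
  · have h₁ := card_le_minrank_add_one_of_iso_pathGraph (by omega) e
    have h₂ := minrank_add_one_le_card G
    rw [Fintype.card_fin] at h₁ h₂
    omega
  · have := hnot h
    omega
end

section
/- For every tree T on n vertices, mr(T) = n − P(T), where P(T) is the path cover number of T, i.e., the maximum nullity of a tree equals its path cover number. -/
open Matrix

/-- A path cover of `G`: a collection of pairwise disjoint vertex subsets, each inducing a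
(nonempty) path in `G`, whose union is all of `V`. -/
def IsPathCover {V : Type*} [Fintype V] (G : SimpleGraph V) (PC : Finset (Finset V)) : Prop :=
  (∀ P ∈ PC, ∃ k : ℕ, 0 < k ∧ Nonempty ((G.induce (P : Set V)) ≃g SimpleGraph.pathGraph k)) ∧
  (∀ P ∈ PC, ∀ Q ∈ PC, P ≠ Q → Disjoint P Q) ∧
  (∀ v : V, ∃ P ∈ PC, v ∈ P)

/-- The path cover number `P(G)`: the minimum number of paths in a path cover of `G`. -/
noncomputable def pathCoverNumber {V : Type*} [Fintype V] (G : SimpleGraph V) : ℕ :=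
  sInf {k : ℕ | ∃ PC : Finset (Finset V), PC.card = k ∧ IsPathCover G PC}

/-- In a finite acyclic graph, no nonempty family of darts is closed under non-backtracking
continuation. -/
theorem SimpleGraph.IsAcyclic.not_forall_exists_continuation {V : Type*} [Fintype V]
    {G : SimpleGraph V} (hG : G.IsAcyclic) {D : V → V → Prop} (hadj : ∀ a b, D a b → G.Adj a b)
    (hstep : ∀ a b, D a b → ∃ c, c ≠ a ∧ D b c) (a b : V) : ¬ D a b := by
  intro hab
  have key : ∀ n : ℕ, ∀ a b, D a b → ∃ (w : V) (p : G.Walk a w), p.length = n + 1 ∧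
      ∃ q : List (Sym2 V), p.edges = s(a, b) :: q ∧ p.edges.IsChain (· ≠ ·) := by
    intro n
    induction n with
    | zero =>
      intro a b h
      exact ⟨b, .cons (hadj a b h) .nil, by simp, [], by simp, by simp⟩
    | succ n ih =>
      intro a b h
      obtain ⟨c, hca, hbc⟩ := hstep a b h
      obtain ⟨w, p, hp, q, hq, hch⟩ := ih b c hbc
      refine ⟨w, .cons (hadj a b h) p, by simp [hp], p.edges, by simp, ?_⟩
      rw [hq] at hch
      rw [SimpleGraph.Walk.edges_cons, hq, List.isChain_cons_cons]
      refine ⟨?_, hch⟩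
      have := (hadj a b h).ne
      intro he
      rw [Sym2.eq_iff] at he
      grind
  obtain ⟨w, p, hp, -, -, hch⟩ := key (Fintype.card V) a b hab
  have := ((hG.isPath_iff_isChain p).2 hch).length_lt
  omega

/-- Let `R` orient some edges of a forest so that every vertex has at most one out-edge.
A null vector of a matrix described by the forest is zero if it vanishes at all vertices without
an in-edge. -/
theorem DescribesGraph.eq_zero_of_mulVec_eq_zero {V : Type*} [Fintype V] {G : SimpleGraph V}
    (hG : G.IsAcyclic) {A : Matrix V V ℝ} (hA : DescribesGraph G A) {R : V → V → Prop}
    (hRadj : ∀ a b, R a b → G.Adj a b) (hRasymm : ∀ a b, R a b → ¬ R b a)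
    (hRinj : ∀ a b c, R a b → R a c → b = c) {x : V → ℝ} (hx : A *ᵥ x = 0)
    (hx0 : ∀ v, (∀ w, ¬ R w v) → x v = 0) : x = 0 := by
  have hD := hG.not_forall_exists_continuation
    (D := fun a b => G.Adj a b ∧ ¬ R a b ∧ (x b ≠ 0 ∨ R b a ∧ x a ≠ 0)) (fun a b h => h.1) ?_
  · ext v
    by_contra hv
    obtain ⟨p, hp⟩ : ∃ p, R p v := by
      by_contra! h
      exact hv (hx0 v h)
    exact hD v p ⟨(hRadj _ _ hp).symm, hRasymm _ _ hp, Or.inr ⟨hp, hv⟩⟩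
  · rintro a b ⟨hab, hR, h⟩
    by_cases hb : x b = 0
    · obtain ⟨hba, ha⟩ := h.resolve_left (not_not_intro hb)
      obtain ⟨w, hwa, hbw, hw⟩ : ∃ w, w ≠ a ∧ G.Adj b w ∧ x w ≠ 0 := by
        by_contra! hcon
        have hsum : ∑ j, A b j * x j = 0 := congrFun hx b
        rw [Finset.sum_eq_single a] at hsum
        · exact mul_ne_zero ((hA.2 b a hab.ne').2 hab.symm) ha hsum
        · intro j _ hj
          by_cases hbj : b = j
          · rw [← hbj, hb, mul_zero]
          · by_cases hadj : G.Adj b j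
            · rw [hcon j hj hadj, mul_zero]
            · rw [not_not.1 (mt (hA.2 b j hbj).1 hadj), zero_mul]
        · simp
      exact ⟨w, hwa, hbw, fun h => hwa (hRinj b w a h hba), Or.inl hw⟩
    · obtain ⟨p, hp⟩ : ∃ p, R p b := by
        by_contra! h
        exact hb (hx0 b h)
      refine ⟨p, ?_, (hRadj _ _ hp).symm, hRasymm _ _ hp, Or.inr ⟨hp, hb⟩⟩
      rintro rfl
      exact hR hp

/-- The nullity of a matrix is at most the size of a vertex set on which no nonzero null vector
vanishes. -/
theorem Matrix.card_le_rank_add_card {V : Type*} [Fintype V] {A : Matrix V V ℝ} (s : Finset V)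
    (h : ∀ x, A *ᵥ x = 0 → (∀ v ∈ s, x v = 0) → x = 0) : Fintype.card V ≤ A.rank + s.card := by
  classical
  have h1 := LinearMap.finrank_range_add_finrank_ker A.mulVecLin
  rw [Module.finrank_fintype_fun_eq_card] at h1
  let φ : LinearMap.ker A.mulVecLin →ₗ[ℝ] (s → ℝ) :=
    (LinearMap.funLeft ℝ ℝ (Subtype.val : s → V)).comp (LinearMap.ker A.mulVecLin).subtype
  have hφ : Function.Injective φ := by
    rw [injective_iff_map_eq_zero]
    rintro ⟨x, hx⟩ h0
    exact Subtype.ext (h x hx fun v hv => congrFun h0 ⟨v, hv⟩)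
  have h2 := LinearMap.finrank_le_finrank_of_injective hφ
  rw [Module.finrank_fintype_fun_eq_card, Fintype.card_coe] at h2
  rw [Matrix.rank]
  omega

/-- The lower bound: the nullity of a matrix described by a forest is at most the size of any
path cover. -/
theorem DescribesGraph.card_le_rank_add_card {V : Type*} [Fintype V] {G : SimpleGraph V}
    (hG : G.IsAcyclic) {A : Matrix V V ℝ} (hA : DescribesGraph G A) {PC : Finset (Finset V)}
    (hPC : IsPathCover G PC) : Fintype.card V ≤ A.rank + PC.card := by
  classical
  obtain ⟨hpath, hdisj, hcov⟩ := hPC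
  choose P hP hvP using hcov
  have hPeq : ∀ Q ∈ PC, ∀ v ∈ Q, P v = Q := by
    intro Q hQ v hv
    by_contra hne
    exact Finset.disjoint_left.1 (hdisj _ (hP v) Q hQ hne) (hvP v) hv
  have hpos : ∀ Q ∈ PC, ∃ (k : ℕ) (pos : V → ℕ),
      (∀ v ∈ Q, pos v < k) ∧ (∀ i < k, ∃ v ∈ Q, pos v = i) ∧
      (∀ v ∈ Q, ∀ w ∈ Q, pos v = pos w → v = w) ∧
      (∀ v ∈ Q, ∀ w ∈ Q, pos v + 1 = pos w → G.Adj v w) := by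
    intro Q hQ
    obtain ⟨k, -, ⟨e⟩⟩ := hpath Q hQ
    refine ⟨k, fun v => if hv : v ∈ (Q : Set V) then (e ⟨v, hv⟩ : ℕ) else 0, ?_, ?_, ?_, ?_⟩
    · intro v hv
      simp [hv]
    · intro i hi
      refine ⟨e.symm ⟨i, hi⟩, (e.symm ⟨i, hi⟩).2, ?_⟩
      simp
    · intro v hv w hw h
      simp only [Finset.mem_coe, hv, hw, dite_true] at h
      simpa using e.injective (Fin.ext h)
    · intro v hv w hw h
      simp only [Finset.mem_coe, hv, hw, dite_true] at h
      have : (SimpleGraph.pathGraph k).Adj (e ⟨v, hv⟩) (e ⟨w, hw⟩) :=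
        SimpleGraph.pathGraph_adj.2 (Or.inl h)
      simpa using e.map_adj_iff.1 this
  choose! k pos hlt hsurj hinj hadj using hpos
  have hcard : (Finset.univ.filter fun v => pos (P v) v = 0).card ≤ PC.card := by
    refine Finset.card_le_card_of_injOn P (fun v _ => hP v) ?_
    intro v hv w hw h
    simp only [Finset.coe_filter, Finset.mem_univ, true_and, Set.mem_ofPred_eq] at hv hw
    exact hinj (P v) (hP v) v (hvP v) w (h ▸ hvP w) (by rw [hv, h, hw])
  refine le_trans (Matrix.card_le_rank_add_card _ ?_) (Nat.add_le_add_left hcard _)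
  intro x hx hx0
  refine hA.eq_zero_of_mulVec_eq_zero hG
    (R := fun a b => P a = P b ∧ pos (P a) a + 1 = pos (P b) b) ?_ ?_ ?_ hx ?_
  · rintro a b ⟨h1, h2⟩
    exact hadj (P a) (hP a) a (hvP a) b (h1 ▸ hvP b) (by rw [h2, h1])
  · rintro a b ⟨h1, h2⟩ ⟨h3, h4⟩
    omega
  · rintro a b c ⟨h1, h2⟩ ⟨h3, h4⟩
    have hbc : P b = P c := h1.symm.trans h3
    exact hinj (P b) (hP b) b (hvP b) c (hbc ▸ hvP c) (by rw [← h2, h4, hbc])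
  · intro v hv
    apply hx0
    simp only [Finset.mem_filter, Finset.mem_univ, true_and]
    by_contra hne
    obtain ⟨w, hw, hwi⟩ := hsurj (P v) (hP v) (pos (P v) v - 1)
      (by have := hlt (P v) (hP v) v (hvP v); omega)
    have hPw := hPeq _ (hP v) w hw
    exact hv w ⟨hPw, by rw [hPw]; omega⟩

/-- `P` is the vertex set of an induced path of `G`, enumerated by an initial segment of `ℕ`. -/
def IsInducedPathSet {V : Type*} (G : SimpleGraph V) (P : Finset V) : Prop :=
  ∃ (k : ℕ) (f : ℕ → V), 0 < k ∧ (∀ i < k, ∀ j < k, f i = f j → i = j) ∧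
    (∀ v, v ∈ P ↔ ∃ i < k, f i = v) ∧
    ∀ i < k, ∀ j < k, (G.Adj (f i) (f j) ↔ i + 1 = j ∨ j + 1 = i)

namespace IsInducedPathSet

variable {V : Type*} {G : SimpleGraph V} {P : Finset V}

theorem exists_iso (h : IsInducedPathSet G P) :
    ∃ k : ℕ, 0 < k ∧ Nonempty ((G.induce (P : Set V)) ≃g SimpleGraph.pathGraph k) := by
  obtain ⟨k, f, hk, hinj, hmem, hadj⟩ := h
  refine ⟨k, hk, ⟨SimpleGraph.Iso.symm
    ⟨Equiv.ofBijective (fun i : Fin k => (⟨f i, (hmem _).2 ⟨i, i.2, rfl⟩⟩ : (P : Set V)))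
      ⟨?_, ?_⟩, ?_⟩⟩⟩
  · intro i j hij
    exact Fin.ext (hinj i i.2 j j.2 (congrArg Subtype.val hij))
  · rintro ⟨v, hv⟩
    obtain ⟨i, hi, rfl⟩ := (hmem v).1 hv
    exact ⟨⟨i, hi⟩, rfl⟩
  · intro i j
    exact (hadj i i.2 j j.2).trans SimpleGraph.pathGraph_adj.symm

theorem singleton (G : SimpleGraph V) (v : V) : IsInducedPathSet G {v} :=
  ⟨1, fun _ => v, one_pos, by omega, by
    intro w
    simp only [Finset.mem_singleton]
    exact ⟨fun h => ⟨0, one_pos, h.symm⟩, fun ⟨_, _, h⟩ => h.symm⟩, by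
    intro i hi j hj
    simp only [SimpleGraph.irrefl, false_iff]
    omega⟩

/-- An induced path can be extended at a vertex with at most one neighbour on it. -/
theorem insert_of_adj [DecidableEq V] (h : IsInducedPathSet G P) {l u : V} (hu : u ∈ P)
    (hl : l ∉ P) (hlu : G.Adj l u) (hleaf : ∀ w ∈ P, G.Adj l w → w = u)
    (hend : ∀ w ∈ P, ∀ w' ∈ P, G.Adj u w → G.Adj u w' → w = w') :
    IsInducedPathSet G (insert l P) := by
  obtain ⟨k, f, hk, hinj, hmem, hadj, hlast⟩ : ∃ (k : ℕ) (f : ℕ → V), 0 < k ∧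
      (∀ i < k, ∀ j < k, f i = f j → i = j) ∧ (∀ v, v ∈ P ↔ ∃ i < k, f i = v) ∧
      (∀ i < k, ∀ j < k, (G.Adj (f i) (f j) ↔ i + 1 = j ∨ j + 1 = i)) ∧ f (k - 1) = u := by
    obtain ⟨k, f, hk, hinj, hmem, hadj⟩ := h
    obtain ⟨i, hi, rfl⟩ := (hmem u).1 hu
    by_cases hik : i = k - 1
    · exact ⟨k, f, hk, hinj, hmem, hadj, by rw [hik]⟩
    by_cases hi0 : i = 0
    · refine ⟨k, fun j => f (k - 1 - j), hk, ?_, ?_, ?_, by simp [hi0]⟩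
      · intro a ha b hb hab
        have := hinj _ (by omega) _ (by omega) hab
        omega
      · intro v
        rw [hmem]
        constructor
        · rintro ⟨a, ha, rfl⟩
          exact ⟨k - 1 - a, by omega, congrArg f (by omega)⟩
        · rintro ⟨a, ha, rfl⟩
          exact ⟨k - 1 - a, by omega, rfl⟩
      · intro a ha b hb
        rw [hadj _ (by omega) _ (by omega)]
        omega
    · have := hinj (i - 1) (by omega) (i + 1) (by omega)
        (hend _ ((hmem _).2 ⟨i - 1, by omega, rfl⟩) _ ((hmem _).2 ⟨i + 1, by omega, rfl⟩)
          ((hadj _ (by omega) _ (by omega)).2 (by omega))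
          ((hadj _ (by omega) _ (by omega)).2 (by omega)))
      omega
  have hfP : ∀ i < k, f i ∈ P := fun i hi => (hmem _).2 ⟨i, hi, rfl⟩
  have hladj : ∀ i < k, (G.Adj l (f i) ↔ i = k - 1) := by
    intro i hi
    constructor
    · intro h
      exact hinj i hi (k - 1) (by omega) ((hleaf _ (hfP i hi) h).trans hlast.symm)
    · rintro rfl
      rwa [hlast]
  refine ⟨k + 1, Function.update f k l, by omega, ?_, ?_, ?_⟩
  · intro i hi j hj hij
    simp only [Function.update_apply] at hij
    grind
  · intro v
    simp only [Finset.mem_insert, hmem, Function.update_apply]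
    constructor
    · rintro (rfl | ⟨i, hi, rfl⟩)
      · exact ⟨k, by omega, by simp⟩
      · exact ⟨i, by omega, by simp [hi.ne]⟩
    · rintro ⟨i, hi, rfl⟩
      by_cases hik : i = k
      · simp [hik]
      · exact Or.inr ⟨i, by omega, by simp [hik]⟩
  · intro i hi j hj
    simp only [Function.update_apply]
    split_ifs with h1 h2 h2
    · simp only [SimpleGraph.irrefl, false_iff]
      omega
    · rw [hladj j (by omega)]
      omega
    · rw [G.adj_comm, hladj i (by omega)]
      omega
    · exact hadj i (by omega) j (by omega)

end IsInducedPathSet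

/-- A nonempty set of vertices of a forest contains an isolated vertex, or a leaf whose neighbour
has at most one further neighbour, or two leaves with a common neighbour (all relative to the
induced subgraph). -/
theorem SimpleGraph.IsAcyclic.exists_isolated_or_leaf {V : Type*} [Fintype V]
    {G : SimpleGraph V} (hG : G.IsAcyclic) {S : Finset V} (hS : S.Nonempty) :
    (∃ v ∈ S, ∀ w ∈ S, ¬ G.Adj v w) ∨
    (∃ l ∈ S, ∃ u ∈ S, G.Adj l u ∧ (∀ w ∈ S, G.Adj l w → w = u) ∧
      ∀ w ∈ S, ∀ w' ∈ S, w ≠ l → w' ≠ l → G.Adj u w → G.Adj u w' → w = w') ∨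
    (∃ u ∈ S, ∃ l ∈ S, ∃ l' ∈ S, l ≠ l' ∧ G.Adj l u ∧ G.Adj l' u ∧
      (∀ w ∈ S, G.Adj l w → w = u) ∧ ∀ w ∈ S, G.Adj l' w → w = u) := by
  by_contra! hcon
  obtain ⟨hiso, hend, htwin⟩ := hcon
  let Leaf : V → Prop := fun l => ∀ w ∈ S, ∀ w' ∈ S, G.Adj l w → G.Adj l w' → w = w'
  have hleaf : ∀ l, Leaf l → ∀ u ∈ S, G.Adj l u → ∀ w ∈ S, G.Adj l w → w = u :=
    fun l hl u hu hlu w hw hlw => hl w hw u hu hlw hlu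
  have htwo : ∀ u ∈ S, ∀ l ∈ S, ∀ l' ∈ S, G.Adj u l → G.Adj u l' → Leaf l → Leaf l' →
      l = l' := by
    intro u hu l hl l' hl' hul hul' h h'
    by_contra hne
    obtain ⟨w, hw, hlw, hwu⟩ := htwin u hu l hl l' hl' hne hul.symm hul'.symm
      (hleaf l h u hu hul.symm)
    exact hwu (hleaf l' h' u hu hul'.symm w hw hlw)
  have hstep : ∀ a, ∀ b ∈ S, ¬ Leaf b → ∃ c ∈ S, c ≠ a ∧ G.Adj b c ∧ ¬ Leaf c := by
    intro a b hb hbl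
    by_contra! h
    obtain ⟨c, hc, hca, hbc⟩ : ∃ c ∈ S, c ≠ a ∧ G.Adj b c := by
      by_contra! h'
      exact hbl fun w hw w' hw' hbw hbw' =>
        (not_imp_not.1 (h' w hw) hbw).trans (not_imp_not.1 (h' w' hw') hbw').symm
    have hcl := h c hc hca hbc
    obtain ⟨w, hw, w', hw', hwc, hwc', hbw, hbw', hne⟩ :=
      hend c hc b hb hbc.symm (hleaf c hcl b hb hbc.symm)
    by_cases hwa : w = a
    · have hwa' : w' ≠ a := fun e => hne (hwa.trans e.symm)
      exact hwc' (htwo b hb w' hw' c hc hbw' hbc (h w' hw' hwa' hbw') hcl)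
    · exact hwc (htwo b hb w hw c hc hbw hbc (h w hw hwa hbw) hcl)
  have hD := hG.not_forall_exists_continuation
    (D := fun a b => G.Adj a b ∧ b ∈ S ∧ ¬ Leaf b) (fun a b h => h.1) (by
      rintro a b ⟨-, hb, hbl⟩
      obtain ⟨c, hc, hca, hbc, hcl⟩ := hstep a b hb hbl
      exact ⟨c, hca, hbc, hc, hcl⟩)
  have hall : ∀ b ∈ S, Leaf b := by
    intro b hb
    by_contra hbl
    obtain ⟨c, hc, -, hbc, hcl⟩ := hstep b b hb hbl
    exact hD b c ⟨hbc, hc, hcl⟩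
  obtain ⟨v, hv⟩ := hS
  obtain ⟨u, hu, hvu⟩ := hiso v hv
  obtain ⟨w, hw, w', hw', -, -, huw, huw', hne⟩ :=
    hend v hv u hu hvu (hleaf v (hall v hv) u hu hvu)
  exact hne (hall u hu w hw w' hw' huw huw')

theorem Matrix.rank_add_vecMulVec_le {V : Type*} [Fintype V] (A : Matrix V V ℝ) (x y : V → ℝ) :
    (A + vecMulVec x y).rank ≤ A.rank + 1 := by
  have hle : LinearMap.range (A + vecMulVec x y).mulVecLin ≤
      LinearMap.range A.mulVecLin ⊔ LinearMap.range (vecMulVec x y).mulVecLin := by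
    rw [Matrix.mulVecLin_add]
    exact LinearMap.range_add_le _ _
  have h1 := (Submodule.finrank_mono hle).trans (Submodule.finrank_add_le_finrank_add_finrank _ _)
  exact h1.trans (Nat.add_le_add_left (rank_vecMulVec_le x y) _)

/-- The upper bound: in every induced subgraph of a forest, some described matrix has nullity at
least the size of some path cover. -/
theorem SimpleGraph.IsAcyclic.exists_matrix_and_pathCover {V : Type*} [Fintype V]
    {G : SimpleGraph V} (hG : G.IsAcyclic) (S : Finset V) :
    ∃ (A : Matrix V V ℝ) (PC : Finset (Finset V)), A.IsSymm ∧
      (∀ i j, i ≠ j → (A i j ≠ 0 ↔ i ∈ S ∧ j ∈ S ∧ G.Adj i j)) ∧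
      (∀ P ∈ PC, IsInducedPathSet G P ∧ P ⊆ S) ∧
      (∀ P ∈ PC, ∀ Q ∈ PC, P ≠ Q → Disjoint P Q) ∧
      (∀ v ∈ S, ∃ P ∈ PC, v ∈ P) ∧ A.rank + PC.card ≤ S.card := by
  classical
  induction S using Finset.strongInduction with
  | H S ih =>
  rcases S.eq_empty_or_nonempty with rfl | hS
  · exact ⟨0, ∅, by simp⟩
  rcases hG.exists_isolated_or_leaf hS with ⟨v, hv, hiso⟩ |
    ⟨l, hl, u, hu, hlu, hleaf, hend⟩ | ⟨u, hu, l, hl, l', hl', hne, hlu, hlu', hleaf, hleaf'⟩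
  · obtain ⟨A, PC, hsymm, hA, hP, hdisj, hcov, hrank⟩ := ih (S.erase v) (Finset.erase_ssubset hv)
    refine ⟨A, insert {v} PC, hsymm, ?_, ?_, ?_, ?_, ?_⟩
    · intro i j hij
      rw [hA i j hij]
      have := hiso i
      have := hiso j
      have := G.adj_comm i j
      grind
    · intro P hPm
      rcases Finset.mem_insert.1 hPm with rfl | hPm
      · exact ⟨.singleton G v, by simpa using hv⟩
      · exact ⟨(hP P hPm).1, (hP P hPm).2.trans (Finset.erase_subset _ _)⟩
    · have hvP : ∀ P ∈ PC, v ∉ P := fun P hPm h => Finset.notMem_erase v S ((hP P hPm).2 h)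
      intro P hPm Q hQm hPQ
      rw [Finset.disjoint_left]
      have := hdisj P
      have := @Finset.disjoint_left V P Q
      grind
    · intro w hw
      by_cases hwv : w = v
      · exact ⟨{v}, by simp, by simp [hwv]⟩
      · obtain ⟨P, hPm, hwP⟩ := hcov w (by simp [hw, hwv])
        exact ⟨P, by simp [hPm], hwP⟩
    · have := Finset.card_insert_le {v} PC
      have := Finset.card_erase_add_one hv
      omega
  · obtain ⟨A, PC, hsymm, hA, hP, hdisj, hcov, hrank⟩ := ih (S.erase l) (Finset.erase_ssubset hl)
    obtain ⟨P, hPm, huP⟩ := hcov u (by simp [hu, hlu.ne'])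
    have hlP : ∀ Q ∈ PC, l ∉ Q := fun Q hQ h => Finset.notMem_erase l S ((hP Q hQ).2 h)
    have hPS : ∀ Q ∈ PC, ∀ w ∈ Q, w ∈ S := fun Q hQ w hw =>
      Finset.mem_of_mem_erase ((hP Q hQ).2 hw)
    let x : V → ℝ := fun i => if i = l ∨ i = u then 1 else 0
    refine ⟨A + vecMulVec x x, insert (insert l P) (PC.erase P), ?_, ?_, ?_, ?_, ?_, ?_⟩
    · refine hsymm.add ?_
      ext i j
      simp [vecMulVec_apply, mul_comm]
    · intro i j hij
      have hAij := hA i j hij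
      simp only [Matrix.add_apply, vecMulVec_apply, x]
      have := hleaf i
      have := hleaf j
      have := G.adj_comm i j
      have := hlu.ne
      by_cases hx : (i = l ∨ i = u) ∧ (j = l ∨ j = u)
      · have h0 : A i j = 0 := by
          by_contra h
          have := hAij.1 h
          grind
        rw [if_pos hx.1, if_pos hx.2, h0]
        have := hlu.symm
        simp only [zero_add, mul_one, ne_eq, one_ne_zero, not_false_iff, true_iff]
        grind
      · have : ((if i = l ∨ i = u then (1 : ℝ) else 0) * if j = l ∨ j = u then 1 else 0) = 0 := by
          rcases not_and_or.1 hx with h | h <;> rw [if_neg h] <;> simp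
        rw [this, add_zero, hAij]
        grind
    · intro Q hQ
      rcases Finset.mem_insert.1 hQ with rfl | hQ
      · refine ⟨(hP P hPm).1.insert_of_adj huP (hlP P hPm) hlu
          (fun w hw => hleaf w (hPS P hPm w hw)) ?_, ?_⟩
        · intro w hw w' hw'
          exact hend w (hPS P hPm w hw) w' (hPS P hPm w' hw')
            (fun h => hlP P hPm (h ▸ hw)) (fun h => hlP P hPm (h ▸ hw'))
        · exact Finset.insert_subset hl (hPS P hPm)
      · exact ⟨(hP Q (Finset.mem_of_mem_erase hQ)).1, hPS Q (Finset.mem_of_mem_erase hQ)⟩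
    · intro Q hQ Q' hQ' hne
      simp only [Finset.disjoint_left] at hdisj ⊢
      intro w hw
      simp only [Finset.mem_insert, Finset.mem_erase] at hQ hQ'
      grind
    · intro w hw
      by_cases hwl : w = l
      · exact ⟨_, Finset.mem_insert_self _ _, by simp [hwl]⟩
      · obtain ⟨Q, hQ, hwQ⟩ := hcov w (by simp [hw, hwl])
        by_cases hQP : Q = P
        · exact ⟨_, Finset.mem_insert_self _ _, by simp [← hQP, hwQ]⟩
        · exact ⟨Q, by simp [hQ, hQP], hwQ⟩
    · have := Finset.card_insert_le (insert l P) (PC.erase P)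
      have := Finset.card_erase_add_one hl
      have := Finset.card_erase_add_one hPm
      have := A.rank_add_vecMulVec_le x x
      omega
  · have hnadj : ¬ G.Adj l l' := fun h => hlu'.ne (hleaf l' hl' h)
    have hnadj' : ¬ G.Adj l' l := fun h => hnadj h.symm
    have hTS : ({l, u, l'} : Finset V) ⊆ S := by
      intro w
      simp only [Finset.mem_insert, Finset.mem_singleton]
      rintro (rfl | rfl | rfl) <;> assumption
    have hTcard : ({l, u, l'} : Finset V).card = 3 := by
      rw [Finset.card_eq_three]
      exact ⟨l, u, l', hlu.ne, hne, hlu'.ne', rfl⟩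
    obtain ⟨A, PC, hsymm, hA, hP, hdisj, hcov, hrank⟩ := ih (S \ {l, u, l'})
      (Finset.sdiff_ssubset hTS ⟨l, by simp⟩)
    let e : V → ℝ := Pi.single u 1
    let y : V → ℝ := fun i => if i ∈ S ∧ G.Adj u i then 1 else 0
    refine ⟨A + vecMulVec e y + vecMulVec y e, insert {l, u, l'} PC, ?_, ?_, ?_, ?_, ?_, ?_⟩
    · rw [add_assoc]
      refine hsymm.add ?_
      ext i j
      simp only [Matrix.transpose_apply, Matrix.add_apply, vecMulVec_apply]
      ring
    · intro i j hij
      have hAij := hA i j hij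
      simp only [Matrix.add_apply, vecMulVec_apply, e, y, Pi.single_apply]
      have := hleaf i
      have := hleaf j
      have := hleaf' i
      have := hleaf' j
      have := G.adj_comm i j
      by_cases hi : i = u
      · subst hi
        have h0 : A i j = 0 := by
          by_contra h
          have := hAij.1 h
          grind
        simp [h0, hij.symm, hu]
      · by_cases hj : j = u
        · subst hj
          have h0 : A i j = 0 := by
            by_contra h
            have := hAij.1 h
            grind
          simp [h0, hi, hu, G.adj_comm j i]
        · simp only [hi, hj, if_false, zero_mul, mul_zero, add_zero]
          rw [hAij]
          grind
    · intro P hPm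
      rcases Finset.mem_insert.1 hPm with rfl | hPm
      · refine ⟨?_, hTS⟩
        have h2 : IsInducedPathSet G {u, l'} := (IsInducedPathSet.singleton G l').insert_of_adj
          (by simp) (by simpa using hlu'.ne') hlu'.symm (by simp) (by simp)
        refine h2.insert_of_adj (u := u) (by simp) (by simp [hlu.ne, hne]) hlu
          (fun w hw => hleaf w (hTS (Finset.mem_insert_of_mem hw))) ?_
        intro w hw w' hw' h h'
        have := h.ne
        have := h'.ne
        grind
      · exact ⟨(hP P hPm).1, (hP P hPm).2.trans Finset.sdiff_subset⟩
    · have hTP : ∀ P ∈ PC, Disjoint P {l, u, l'} := fun P hPm =>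
        Finset.disjoint_of_subset_left (hP P hPm).2 Finset.sdiff_disjoint
      intro P hPm Q hQm hPQ
      rcases Finset.mem_insert.1 hPm with rfl | hPm <;>
        rcases Finset.mem_insert.1 hQm with rfl | hQm
      · exact absurd rfl hPQ
      · exact (hTP Q hQm).symm
      · exact hTP P hPm
      · exact hdisj P hPm Q hQm hPQ
    · intro w hw
      by_cases hwT : w ∈ ({l, u, l'} : Finset V)
      · exact ⟨_, Finset.mem_insert_self _ _, hwT⟩
      · obtain ⟨P, hPm, hwP⟩ := hcov w (Finset.mem_sdiff.2 ⟨hw, hwT⟩)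
        exact ⟨P, Finset.mem_insert_of_mem hPm, hwP⟩
    · have := Finset.card_insert_le {l, u, l'} PC
      have := Finset.card_sdiff_add_card_eq_card hTS
      have := A.rank_add_vecMulVec_le e y
      have := (A + vecMulVec e y).rank_add_vecMulVec_le y e
      omega

/-- For every tree `T` on `n` vertices, `mr(T) = n - P(T)` where `P(T)` is the path cover
number; i.e., the maximum nullity of a tree equals its path cover number. -/
theorem minrank_tree_eq_card_sub_pathCoverNumber (V : Type*) [Fintype V] (T : SimpleGraph V)
    (hconn : T.Connected) (hacyc : T.IsAcyclic) :
    minrank T = Fintype.card V - pathCoverNumber T := by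
  obtain ⟨A, PC, hsymm, hA, hP, hdisj, hcov, hrank⟩ :=
    hacyc.exists_matrix_and_pathCover Finset.univ
  have hdesc : DescribesGraph T A := ⟨hsymm, fun i j hij => by simpa using hA i j hij⟩
  have hcover : IsPathCover T PC :=
    ⟨fun P hPm => (hP P hPm).1.exists_iso, hdisj, fun v => hcov v (Finset.mem_univ v)⟩
  rw [Finset.card_univ] at hrank
  have hmr : minrank T ≤ A.rank := Nat.sInf_le ⟨A, hdesc, rfl⟩
  have hpc : pathCoverNumber T ≤ PC.card := Nat.sInf_le ⟨PC, rfl, hcover⟩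
  obtain ⟨B, hB, hBrank⟩ : ∃ B, DescribesGraph T B ∧ B.rank = minrank T :=
    Nat.sInf_mem (s := {r : ℕ | ∃ A, DescribesGraph T A ∧ A.rank = r}) ⟨_, A, hdesc, rfl⟩
  obtain ⟨PC', hcard, hPC'⟩ : ∃ PC : Finset (Finset V),
      PC.card = pathCoverNumber T ∧ IsPathCover T PC :=
    Nat.sInf_mem (s := {k : ℕ | ∃ PC : Finset (Finset V), PC.card = k ∧ IsPathCover T PC})
      ⟨_, PC, rfl, hcover⟩
  have := hB.card_le_rank_add_card hacyc hPC'
  omega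
end
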